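/- In the D-OCO setting with every loss f_i^t additionally μ-strongly convex on W (μ > 0), assume L = ⌈1/δ⌉ divides T and run D-FTFCL with strongly convex update w^{b+1} = argmin_{w ∈ W} ⟨Σ_{k=1}^{b−2} s^k, w⟩ + (μL/2) Σ_{k=1}^b ‖w − w^k‖². Then the expected regret over the compressor randomness satisfies E[R_T] ≤ 42 L (G + μD)² (1 + log T) / μ, with L = ⌈1/δ⌉. -/

import Mathlib

open MeasureTheory Real
open scoped ENNReal NNReal BigOperators RealInnerProductSpace

/-- A minimizer of a linearly perturbed sum of squared distances moves in proportion to the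
perturbation. -/
lemma norm_sub_le_of_minimizers {E : Type*} [NormedAddCommGroup E] [InnerProductSpace ℝ E]
    {W : Set E} (hW : Convex ℝ W) {m : ℝ} (hm : 0 < m) {N : ℕ} (hN : 1 ≤ N) (c : ℕ → E)
    (p q x y : E) (hx : x ∈ W) (hy : y ∈ W)
    (hxmin : ∀ u ∈ W, ⟪p, x⟫ + m / 2 * ∑ k ∈ Finset.Icc 1 N, ‖x - c k‖ ^ 2
      ≤ ⟪p, u⟫ + m / 2 * ∑ k ∈ Finset.Icc 1 N, ‖u - c k‖ ^ 2)
    (hymin : ∀ u ∈ W, ⟪q, y⟫ + m / 2 * ∑ k ∈ Finset.Icc 1 N, ‖y - c k‖ ^ 2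
      ≤ ⟪q, u⟫ + m / 2 * ∑ k ∈ Finset.Icc 1 N, ‖u - c k‖ ^ 2) :
    ‖x - y‖ ≤ 2 * ‖q - p‖ / (m * N) := by
  have hmid : (1 / 2 : ℝ) • x + (1 / 2 : ℝ) • y ∈ W :=
    hW hx hy (by norm_num) (by norm_num) (by norm_num)
  have hsq : ∀ k, ‖(1 / 2 : ℝ) • x + (1 / 2 : ℝ) • y - c k‖ ^ 2
      = ‖x - c k‖ ^ 2 / 2 + ‖y - c k‖ ^ 2 / 2 - ‖x - y‖ ^ 2 / 4 := by
    intro k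
    have h1 := parallelogram_law_with_norm ℝ (x - c k) (y - c k)
    have h2 : (1 / 2 : ℝ) • x + (1 / 2 : ℝ) • y - c k
        = (1 / 2 : ℝ) • ((x - c k) + (y - c k)) := by module
    have h3 : (x - c k) - (y - c k) = x - y := by abel
    rw [h2, norm_smul, Real.norm_of_nonneg (by norm_num : (0 : ℝ) ≤ 1 / 2)]
    rw [h3] at h1
    nlinarith
  have h1 := hxmin _ hmid
  have h2 := hymin _ hmid
  simp only [hsq, Finset.sum_sub_distrib, Finset.sum_add_distrib, ← Finset.sum_div,
    Finset.sum_const, Nat.card_Icc, Nat.add_sub_cancel, nsmul_eq_mul, inner_add_right,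
    inner_smul_right] at h1 h2
  have hcs := real_inner_le_norm (q - p) (x - y)
  simp only [inner_sub_left, inner_sub_right] at hcs
  have hN' : (0 : ℝ) < N := by exact_mod_cast hN
  have hmN : 0 < m * N := by positivity
  have key : m * N * ‖x - y‖ ^ 2 ≤ 2 * (‖q - p‖ * ‖x - y‖) := by nlinarith
  rw [le_div_iff₀ hmN]
  rcases (norm_nonneg (x - y)).eq_or_lt with h0 | h0
  · rw [← h0]; simp
  · exact le_of_mul_le_mul_right (by nlinarith) h0

/-- Regret of a perturbed follow-the-leader strategy on quadratic surrogate losses. -/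
lemma ftl_regret_le {E : Type*} [NormedAddCommGroup E] [InnerProductSpace ℝ E]
    {W : Set E} (hWc : IsCompact W) (hW : Convex ℝ W) {m : ℝ} (hm : 0 < m) (K : ℕ)
    (g p w : ℕ → E) (hw : ∀ b ∈ Finset.Icc 1 K, w b ∈ W)
    (hmin : ∀ b ∈ Finset.Icc 1 K, ∀ u ∈ W,
      ⟪p b, w b⟫ + m / 2 * ∑ k ∈ Finset.Icc 1 b, ‖w b - w k‖ ^ 2
        ≤ ⟪p b, u⟫ + m / 2 * ∑ k ∈ Finset.Icc 1 b, ‖u - w k‖ ^ 2)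
    (u : E) (hu : u ∈ W) :
    ∑ b ∈ Finset.Icc 1 K, (⟪g b, w b - u⟫ - m / 2 * ‖u - w b‖ ^ 2)
      ≤ ∑ b ∈ Finset.Icc 1 K,
          ‖g b‖ * (2 * ‖∑ k ∈ Finset.Icc 1 b, g k - p b‖ / (m * b)) := by
  have hexists : ∀ b : ℕ, ∃ y ∈ W, ∀ u ∈ W,
      ⟪∑ k ∈ Finset.Icc 1 b, g k, y⟫ + m / 2 * ∑ k ∈ Finset.Icc 1 b, ‖y - w k‖ ^ 2
        ≤ ⟪∑ k ∈ Finset.Icc 1 b, g k, u⟫ + m / 2 * ∑ k ∈ Finset.Icc 1 b, ‖u - w k‖ ^ 2 := by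
    intro b
    obtain ⟨y, hy, hymin⟩ := hWc.exists_isMinOn ⟨u, hu⟩
      (f := fun u => ⟪∑ k ∈ Finset.Icc 1 b, g k, u⟫
        + m / 2 * ∑ k ∈ Finset.Icc 1 b, ‖u - w k‖ ^ 2) (by fun_prop)
    exact ⟨y, hy, fun u hu => hymin hu⟩
  choose y hyW hymin using hexists
  have hleader : ∀ B : ℕ, ∀ u ∈ W,
      ∑ b ∈ Finset.Icc 1 B, (⟪g b, y b⟫ + m / 2 * ‖y b - w b‖ ^ 2)
        ≤ ∑ b ∈ Finset.Icc 1 B, (⟪g b, u⟫ + m / 2 * ‖u - w b‖ ^ 2) := by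
    intro B
    induction B with
    | zero => intro u _; simp
    | succ B ih =>
      intro u hu
      have h1 := ih (y (B + 1)) (hyW _)
      have h2 := hymin (B + 1) u hu
      simp only [sum_inner, Finset.mul_sum, ← Finset.sum_add_distrib] at h2
      refine le_trans ?_ h2
      rw [Finset.sum_Icc_succ_top (by omega), Finset.sum_Icc_succ_top (by omega)]
      gcongr
  have hdist : ∀ b ∈ Finset.Icc 1 K,
      ⟪g b, w b⟫ - (⟪g b, y b⟫ + m / 2 * ‖y b - w b‖ ^ 2)
        ≤ ‖g b‖ * (2 * ‖∑ k ∈ Finset.Icc 1 b, g k - p b‖ / (m * b)) := by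
    intro b hb
    have h1 := norm_sub_le_of_minimizers hW hm (Finset.mem_Icc.1 hb).1 w (p b)
      (∑ k ∈ Finset.Icc 1 b, g k) (w b) (y b) (hw b hb) (hyW b) (hmin b hb) (hymin b)
    have h2 := real_inner_le_norm (g b) (w b - y b)
    rw [inner_sub_right] at h2
    have h3 : 0 ≤ m / 2 * ‖y b - w b‖ ^ 2 := by positivity
    have h4 := mul_le_mul_of_nonneg_left h1 (norm_nonneg (g b))
    linarith
  have h5 := Finset.sum_le_sum hdist
  have h6 := hleader K u hu
  refine le_trans ?_ h5
  rw [Finset.sum_sub_distrib]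
  simp only [inner_sub_right, Finset.sum_sub_distrib, Finset.sum_add_distrib] at h6 ⊢
  linarith

/-- Error feedback with a `2/3`-contraction in `L²` keeps the residual within twice the input. -/
lemma eLpNorm_errorFeedback_le {Ω E : Type*} [MeasurableSpace Ω] [NormedAddCommGroup E]
    (P : Measure Ω) (K : ℕ) (c : ℝ≥0∞) (e x v : ℕ → Ω → E)
    (he : ∀ b, 1 ≤ b → AEStronglyMeasurable (e b) P)
    (hx : ∀ b, 1 ≤ b → AEStronglyMeasurable (x b) P)
    (hxc : ∀ b ∈ Finset.Icc 1 K, eLpNorm (x b) 2 P ≤ c)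
    (he1 : e 1 = fun _ => 0)
    (hrec : ∀ b, 1 ≤ b → ∀ ω, e (b + 1) ω = e b ω + x b ω - v b ω)
    (hcontr : ∀ b ∈ Finset.Icc 1 K,
      ∫⁻ ω, (‖v b ω - (e b ω + x b ω)‖₊ : ℝ≥0∞) ^ 2 ∂P
        ≤ (2 / 3) ^ 2 * ∫⁻ ω, (‖e b ω + x b ω‖₊ : ℝ≥0∞) ^ 2 ∂P) :
    ∀ b ∈ Finset.Icc 1 (K + 1), eLpNorm (e b) 2 P ≤ 2 * c := by
  have hsq : ∀ f : Ω → E, ∫⁻ ω, (‖f ω‖₊ : ℝ≥0∞) ^ 2 ∂P = eLpNorm f 2 P ^ 2 := by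
    intro f
    have := eLpNorm_nnreal_pow_eq_lintegral (f := f) (μ := P) (p := 2) (by norm_num)
    simpa [enorm_eq_nnnorm] using this.symm
  intro b hb
  rw [Finset.mem_Icc] at hb
  obtain ⟨hb1, hbK⟩ := hb
  induction b, hb1 using Nat.le_induction with
  | base => rw [he1]; simp
  | succ b hb ih =>
    have hbm : b ∈ Finset.Icc 1 K := Finset.mem_Icc.2 ⟨hb, by omega⟩
    have h1 := hcontr b hbm
    rw [hsq (fun ω => v b ω - (e b ω + x b ω)), hsq (fun ω => e b ω + x b ω), ← mul_pow] at h1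
    have h2 := (ENNReal.pow_le_pow_left_iff two_ne_zero).1 h1
    have h3 : e (b + 1) = -(fun ω => v b ω - (e b ω + x b ω)) := by
      funext ω
      simp [hrec b hb ω]
    rw [h3, eLpNorm_neg]
    calc _ ≤ _ := h2
      _ ≤ 2 / 3 * (2 * c + c) := by
        gcongr
        exact (eLpNorm_add_le (he b hb) (hx b hb) (by norm_num)).trans
          (add_le_add (ih (by omega)) (hxc b hbm))
      _ = 2 * c := by
        rw [show 2 * c + c = 3 * c by ring, ← mul_assoc, ENNReal.div_mul_cancel (by norm_num)
          (by norm_num)]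

lemma sum_Icc_blocks {M : Type*} [AddCommMonoid M] (L K : ℕ) (a : ℕ → M) :
    ∑ t ∈ Finset.Icc 1 (K * L), a t
      = ∑ b ∈ Finset.Icc 1 K, ∑ t ∈ Finset.Icc ((b - 1) * L + 1) (b * L), a t := by
  induction K with
  | zero => simp
  | succ K ih =>
    rw [Finset.sum_Icc_succ_top (by omega), ← ih, Nat.add_sub_cancel]
    have h : ∀ N, Finset.Icc 1 N = Finset.Ioc 0 N := fun N => by ext; simp; omega
    have h' : Finset.Icc (K * L + 1) ((K + 1) * L) = Finset.Ioc (K * L) ((K + 1) * L) := by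
      ext; simp
    rw [h, h, h', Finset.sum_Ioc_consecutive _ (by omega) (by gcongr; simp)]

lemma measurable_gradient {E : Type*} [NormedAddCommGroup E] [InnerProductSpace ℝ E]
    [CompleteSpace E] [MeasurableSpace E] [BorelSpace E] (f : E → ℝ) :
    Measurable (gradient f) := by
  unfold gradient
  exact (InnerProductSpace.toDual ℝ E).symm.continuous.measurable.comp (measurable_fderiv ℝ f)

lemma one_sub_pow_ceil_le {δ : ℝ} (h0 : 0 < δ) (h1 : δ ≤ 1) :
    (1 - δ) ^ ⌈1 / δ⌉₊ ≤ (2 / 3 : ℝ) ^ 2 := by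
  have hL : 1 / δ ≤ (⌈1 / δ⌉₊ : ℝ) := Nat.le_ceil _
  have h2 : 1 ≤ (⌈1 / δ⌉₊ : ℝ) * δ := by rwa [div_le_iff₀ h0] at hL
  calc (1 - δ) ^ ⌈1 / δ⌉₊ ≤ (Real.exp (-δ)) ^ ⌈1 / δ⌉₊ := by
        exact pow_le_pow_left₀ (by linarith) (Real.one_sub_le_exp_neg δ) _
    _ = Real.exp (⌈1 / δ⌉₊ * -δ) := by rw [← Real.exp_nat_mul]
    _ ≤ Real.exp (-1) := by gcongr; linarith
    _ ≤ (2 / 3) ^ 2 := by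
      have := Real.exp_neg_one_lt_d9
      norm_num at this ⊢
      linarith

lemma eLpNorm_average_le {Ω E : Type*} [MeasurableSpace Ω] [NormedAddCommGroup E]
    [NormedSpace ℝ E] (P : Measure Ω) {n : ℕ} (hn : 1 ≤ n) (c : ℝ≥0∞) (x : ℕ → Ω → E)
    (hx : ∀ i ∈ Finset.Icc 1 n, AEStronglyMeasurable (x i) P)
    (hc : ∀ i ∈ Finset.Icc 1 n, eLpNorm (x i) 2 P ≤ c) :
    eLpNorm (fun ω => (n : ℝ)⁻¹ • ∑ i ∈ Finset.Icc 1 n, x i ω) 2 P ≤ c := by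
  have h1 : (fun ω => (n : ℝ)⁻¹ • ∑ i ∈ Finset.Icc 1 n, x i ω)
      = (n : ℝ)⁻¹ • ∑ i ∈ Finset.Icc 1 n, x i := by
    funext ω; simp
  have hn' : (n : ℝ) ≠ 0 := by positivity
  rw [h1, eLpNorm_const_smul]
  calc _ ≤ ‖(n : ℝ)⁻¹‖ₑ * (n * c) := by
        gcongr
        refine (eLpNorm_sum_le hx (by norm_num)).trans ((Finset.sum_le_sum hc).trans ?_)
        simp
    _ = c := by
      rw [enorm_inv hn', Real.enorm_natCast, ← mul_assoc, ENNReal.inv_mul_cancel, one_mul]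
      · exact_mod_cast (by omega : n ≠ 0)
      · exact ENNReal.natCast_ne_top n

lemma eLpNorm_two_le_of_norm_le {Ω E : Type*} [MeasurableSpace Ω] [NormedAddCommGroup E]
    (P : Measure Ω) [IsProbabilityMeasure P] {C : ℝ} {x : Ω → E} (hx : ∀ ω, ‖x ω‖ ≤ C) :
    eLpNorm x 2 P ≤ ENNReal.ofReal C := by
  simpa using eLpNorm_le_of_ae_bound (p := 2) (μ := P) (Filter.Eventually.of_forall hx)

lemma lintegral_enorm_le_eLpNorm_two {Ω E : Type*} [MeasurableSpace Ω] [NormedAddCommGroup E]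
    (P : Measure Ω) [IsProbabilityMeasure P] {x : Ω → E} (hx : AEStronglyMeasurable x P) :
    ∫⁻ ω, ‖x ω‖ₑ ∂P ≤ eLpNorm x 2 P := by
  rw [← eLpNorm_one_eq_lintegral_enorm]
  exact eLpNorm_le_eLpNorm_of_exponent_le (by norm_num) hx

/-- The block-wise linearization of the regret of strongly convex losses. -/
lemma blockRegret_le {E : Type*} [NormedAddCommGroup E] [InnerProductSpace ℝ E]
    [CompleteSpace E] {W : Set E} {n L K : ℕ} (hn : 1 ≤ n) (hL : 1 ≤ L) (μ : ℝ)
    (f : ℕ → ℕ → E → ℝ)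
    (hsc : ∀ i ∈ Finset.Icc 1 n, ∀ t ∈ Finset.Icc 1 (K * L), ∀ x ∈ W, ∀ y ∈ W,
      f i t x + ⟪gradient (f i t) x, y - x⟫ + μ / 2 * ‖y - x‖ ^ 2 ≤ f i t y)
    (w : ℕ → E) (hw : ∀ b ∈ Finset.Icc 1 K, w b ∈ W) (u : E) (hu : u ∈ W) :
    (n : ℝ)⁻¹ * ∑ t ∈ Finset.Icc 1 (K * L), ∑ i ∈ Finset.Icc 1 n, f i t (w ((t + L - 1) / L))
        - (n : ℝ)⁻¹ * ∑ t ∈ Finset.Icc 1 (K * L), ∑ i ∈ Finset.Icc 1 n, f i t u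
      ≤ ∑ b ∈ Finset.Icc 1 K,
        (⟪(n : ℝ)⁻¹ • ∑ i ∈ Finset.Icc 1 n,
            ∑ t ∈ Finset.Icc ((b - 1) * L + 1) (b * L), gradient (f i t) (w b), w b - u⟫
          - μ * L / 2 * ‖u - w b‖ ^ 2) := by
  have hn' : (0 : ℝ) < n := by exact_mod_cast hn
  rw [← mul_sub, ← Finset.sum_sub_distrib, sum_Icc_blocks, Finset.mul_sum]
  refine Finset.sum_le_sum fun b hb => ?_
  have hb' := Finset.mem_Icc.1 hb
  have hcard : b * L + 1 - ((b - 1) * L + 1) = L := by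
    obtain ⟨a, rfl⟩ : ∃ a, b = a + 1 := ⟨b - 1, by omega⟩
    rw [Nat.add_sub_cancel, add_mul]; omega
  rw [inner_smul_left, Finset.sum_comm, sum_inner]
  simp only [sum_inner, conj_trivial]
  have h : ∀ t ∈ Finset.Icc ((b - 1) * L + 1) (b * L),
      ∑ i ∈ Finset.Icc 1 n, f i t (w ((t + L - 1) / L)) - ∑ i ∈ Finset.Icc 1 n, f i t u
        ≤ ∑ i ∈ Finset.Icc 1 n, ⟪gradient (f i t) (w b), w b - u⟫
          - n * (μ / 2 * ‖u - w b‖ ^ 2) := by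
    intro t ht
    have ht' := Finset.mem_Icc.1 ht
    have hbL : b * L ≤ K * L := Nat.mul_le_mul_right L hb'.2
    have hblock : (t + L - 1) / L = b := by
      obtain ⟨a, rfl⟩ : ∃ a, b = a + 1 := ⟨b - 1, by omega⟩
      rw [Nat.add_sub_cancel] at ht'
      rw [Nat.div_eq_iff (by omega)]
      rw [add_mul] at *
      omega
    have hsum : ∑ i ∈ Finset.Icc 1 n, μ / 2 * ‖u - w b‖ ^ 2 = n * (μ / 2 * ‖u - w b‖ ^ 2) := by
      simp
    rw [hblock, ← hsum, ← Finset.sum_sub_distrib, ← Finset.sum_sub_distrib]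
    refine Finset.sum_le_sum fun i hi => ?_
    have h1 := hsc i hi t (Finset.mem_Icc.2 ⟨by omega, by omega⟩) (w b) (hw b hb) u hu
    rw [← neg_sub (w b) u, inner_neg_right, neg_sub] at h1
    linarith
  have h2 := Finset.sum_le_sum h
  rw [Finset.sum_sub_distrib (g := fun _ => (n : ℝ) * (μ / 2 * ‖u - w b‖ ^ 2)),
    Finset.sum_const, Nat.card_Icc, hcard, nsmul_eq_mul] at h2
  refine (mul_le_mul_of_nonneg_left h2 (inv_nonneg.2 hn'.le)).trans (le_of_eq ?_)
  field_simp

lemma sum_Icc_inv_le_one_add_log (K : ℕ) :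
    ∑ b ∈ Finset.Icc 1 K, (b : ℝ)⁻¹ ≤ 1 + Real.log K := by
  have := harmonic_le_one_add_log K
  rw [harmonic_eq_sum_Icc] at this
  simpa using this

/-- regret of D-FTFCL for strongly convex losses. In the D-OCO setting
over a compact convex domain `W ∋ 0` of diameter at most `D`, with `μ`-strongly convex
differentiable losses `f_i^t` whose (individual and averaged) gradients are bounded by `G`
on `W`, assume `L = ⌈1/δ⌉` divides `T` and run D-FTFCL with block size `L` (`K = T/L`
blocks) and the strongly convex update
`w^{b+1} = argmin_{w ∈ W} ⟨Σ_{k=1}^{b−2} s^k, w⟩ + (μL/2) Σ_{k=1}^b ‖w − w^k‖²`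
(empty sums are `0`). Then the expected regret satisfies
`E[R_T] ≤ 42 L (G + μD)² (1 + log T) / μ`.

The FCC guarantee `E[‖FCC(x,C,L) − x‖²] ≤ (1−δ)^L E[‖x‖²]` for inputs depending only on
past invocations is encoded by the hypotheses `hFCClearner` and `hFCCserver`. -/
theorem dftfcl_strongly_convex_regret
    {d n T : ℕ} (hn : 1 ≤ n) (hT : 1 ≤ T)
    {Ω : Type*} [MeasurableSpace Ω] (μpr : Measure Ω) [IsProbabilityMeasure μpr]
    (W : Set (EuclideanSpace ℝ (Fin d)))
    (hWcpt : IsCompact W) (hWconv : Convex ℝ W)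
    (hW0 : (0 : EuclideanSpace ℝ (Fin d)) ∈ W)
    (D G δ μ : ℝ) (hD : 0 < D) (hG : 0 < G) (hδ0 : 0 < δ) (hδ1 : δ ≤ 1) (hμ : 0 < μ)
    (hdiam : ∀ x ∈ W, ∀ y ∈ W, ‖x - y‖ ≤ D)
    (L : ℕ) (hL : L = ⌈1 / δ⌉₊) (hdvd : L ∣ T)
    (f : ℕ → ℕ → EuclideanSpace ℝ (Fin d) → ℝ)
    (hdiff : ∀ i ∈ Finset.Icc 1 n, ∀ t ∈ Finset.Icc 1 T, Differentiable ℝ (f i t))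
    (hsc : ∀ i ∈ Finset.Icc 1 n, ∀ t ∈ Finset.Icc 1 T, ∀ x ∈ W, ∀ y ∈ W,
      f i t x + ⟪gradient (f i t) x, y - x⟫ + μ / 2 * ‖y - x‖ ^ 2 ≤ f i t y)
    (hgrad : ∀ i ∈ Finset.Icc 1 n, ∀ t ∈ Finset.Icc 1 T, ∀ u ∈ W,
      ‖gradient (f i t) u‖ ≤ G)
    (hgradavg : ∀ t ∈ Finset.Icc 1 T, ∀ u ∈ W,
      ‖(n : ℝ)⁻¹ • ∑ i ∈ Finset.Icc 1 n, gradient (f i t) u‖ ≤ G)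
    (w : ℕ → Ω → EuclideanSpace ℝ (Fin d))
    (z v e : ℕ → ℕ → Ω → EuclideanSpace ℝ (Fin d))
    (vbar s ehat : ℕ → Ω → EuclideanSpace ℝ (Fin d))
    (hmw : ∀ b, Measurable (w b)) (hmv : ∀ i b, Measurable (v i b))
    (hms : ∀ b, Measurable (s b))
    (hw1 : w 1 = fun _ => 0)
    (hzdef : ∀ i, ∀ b, 1 ≤ b → ∀ ω,
      z i b ω = ∑ t ∈ Finset.Icc ((b - 1) * L + 1) (b * L), gradient (f i t) (w b ω))
    (he1 : ∀ i, e i 1 = fun _ => 0)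
    (hehat1 : ehat 1 = fun _ => 0)
    (herec : ∀ i, ∀ b, 1 ≤ b → ∀ ω, e i (b + 1) ω = e i b ω + z i b ω - v i b ω)
    (hvbar : ∀ b ω, vbar b ω = (n : ℝ)⁻¹ • ∑ i ∈ Finset.Icc 1 n, v i b ω)
    (hehatrec : ∀ b, 1 ≤ b → ∀ ω, ehat (b + 1) ω = ehat b ω + vbar b ω - s b ω)
    (hFCClearner : ∀ i ∈ Finset.Icc 1 n, ∀ b ∈ Finset.Icc 1 (T / L),
      ∫⁻ ω, (‖v i b ω - (e i b ω + z i b ω)‖₊ : ℝ≥0∞) ^ 2 ∂μpr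
        ≤ ENNReal.ofReal ((1 - δ) ^ L) *
          ∫⁻ ω, (‖e i b ω + z i b ω‖₊ : ℝ≥0∞) ^ 2 ∂μpr)
    (hFCCserver : ∀ b ∈ Finset.Icc 1 (T / L),
      ∫⁻ ω, (‖s b ω - (ehat b ω + vbar b ω)‖₊ : ℝ≥0∞) ^ 2 ∂μpr
        ≤ ENNReal.ofReal ((1 - δ) ^ L) *
          ∫⁻ ω, (‖ehat b ω + vbar b ω‖₊ : ℝ≥0∞) ^ 2 ∂μpr)
    (hupdateW : ∀ b ∈ Finset.Icc 1 (T / L), ∀ ω, w (b + 1) ω ∈ W)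
    (hupdate : ∀ b ∈ Finset.Icc 1 (T / L), ∀ ω, ∀ u ∈ W,
      ⟪∑ k ∈ Finset.Icc 1 (b - 2), s k ω, w (b + 1) ω⟫
          + μ * (L : ℝ) / 2 * ∑ k ∈ Finset.Icc 1 b, ‖w (b + 1) ω - w k ω‖ ^ 2
        ≤ ⟪∑ k ∈ Finset.Icc 1 (b - 2), s k ω, u⟫
          + μ * (L : ℝ) / 2 * ∑ k ∈ Finset.Icc 1 b, ‖u - w k ω‖ ^ 2) :
    ∫⁻ ω, ENNReal.ofReal
        ((n : ℝ)⁻¹ * ∑ t ∈ Finset.Icc 1 T, ∑ i ∈ Finset.Icc 1 n,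
            f i t (w ((t + L - 1) / L) ω)
          - ⨅ u : W, (n : ℝ)⁻¹ * ∑ t ∈ Finset.Icc 1 T, ∑ i ∈ Finset.Icc 1 n,
            f i t u) ∂μpr
      ≤ ENNReal.ofReal (42 * (L : ℝ) * (G + μ * D) ^ 2 * (1 + Real.log T) / μ) := by
  have hL1 : 1 ≤ L := by
    rw [hL]; exact Nat.ceil_pos.2 (by positivity)
  obtain ⟨K, rfl⟩ : ∃ K, T = K * L := ⟨T / L, (Nat.div_mul_cancel hdvd).symm⟩
  rw [Nat.mul_div_cancel K hL1] at *
  have hLpos : (0 : ℝ) < L := by exact_mod_cast hL1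
  have hcontr : ENNReal.ofReal ((1 - δ) ^ L) ≤ (2 / 3) ^ 2 := by
    rw [hL]
    refine (ENNReal.ofReal_le_ofReal (one_sub_pow_ceil_le hδ0 hδ1)).trans (le_of_eq ?_)
    rw [ENNReal.ofReal_pow (by norm_num), ENNReal.ofReal_div_of_pos (by norm_num)]
    simp
  have hwW : ∀ b ∈ Finset.Icc 1 K, ∀ ω, w b ω ∈ W := by
    intro b hb ω
    obtain ⟨hb1, hbK⟩ := Finset.mem_Icc.1 hb
    rcases hb1.eq_or_lt with h | h
    · rw [← h, hw1]; exact hW0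
    · have := hupdateW (b - 1) (Finset.mem_Icc.2 ⟨by omega, by omega⟩) ω
      rwa [Nat.sub_add_cancel hb1] at this
  have hround : ∀ b ∈ Finset.Icc 1 K, ∀ t ∈ Finset.Icc ((b - 1) * L + 1) (b * L),
      t ∈ Finset.Icc 1 (K * L) := by
    intro b hb t ht
    have hbL : b * L ≤ K * L := Nat.mul_le_mul_right L (Finset.mem_Icc.1 hb).2
    rw [Finset.mem_Icc] at ht ⊢
    omega
  have hcard : ∀ b ∈ Finset.Icc 1 K,
      (Finset.Icc ((b - 1) * L + 1) (b * L)).card = L := by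
    intro b hb
    obtain ⟨a, rfl⟩ : ∃ a, b = a + 1 := ⟨b - 1, by have := Finset.mem_Icc.1 hb; omega⟩
    rw [Nat.card_Icc, Nat.add_sub_cancel, add_mul]; omega
  have hznorm : ∀ i ∈ Finset.Icc 1 n, ∀ b ∈ Finset.Icc 1 K, ∀ ω, ‖z i b ω‖ ≤ L * G := by
    intro i hi b hb ω
    rw [hzdef i b (Finset.mem_Icc.1 hb).1 ω]
    refine (norm_sum_le_of_le _ fun t ht => hgrad i hi t (hround b hb t ht) _ (hwW b hb ω)).trans ?_
    rw [Finset.sum_const, hcard b hb, nsmul_eq_mul]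
  set g : ℕ → Ω → EuclideanSpace ℝ (Fin d) :=
    fun b ω => (n : ℝ)⁻¹ • ∑ i ∈ Finset.Icc 1 n, z i b ω with hg
  set ebar : ℕ → Ω → EuclideanSpace ℝ (Fin d) :=
    fun b ω => (n : ℝ)⁻¹ • ∑ i ∈ Finset.Icc 1 n, e i b ω with hebar
  have hgnorm : ∀ b ∈ Finset.Icc 1 K, ∀ ω, ‖g b ω‖ ≤ L * G := by
    intro b hb ω
    have h1 : g b ω = ∑ t ∈ Finset.Icc ((b - 1) * L + 1) (b * L),
        (n : ℝ)⁻¹ • ∑ i ∈ Finset.Icc 1 n, gradient (f i t) (w b ω) := by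
      rw [← Finset.smul_sum, Finset.sum_comm]
      simp only [hg, hzdef _ b (Finset.mem_Icc.1 hb).1 ω]
    rw [h1]
    refine (norm_sum_le_of_le _ fun t ht => hgradavg t (hround b hb t ht) _ (hwW b hb ω)).trans ?_
    rw [Finset.sum_const, hcard b hb, nsmul_eq_mul]
  have hzm : ∀ i b, 1 ≤ b → Measurable (z i b) := by
    intro i b hb
    rw [funext (hzdef i b hb)]
    exact Finset.measurable_fun_sum _ fun t _ => (measurable_gradient (f i t)).comp (hmw b)
  have hem : ∀ i b, 1 ≤ b → Measurable (e i b) := by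
    intro i b hb
    induction b, hb using Nat.le_induction with
    | base => rw [he1]; exact measurable_const
    | succ b hb ih =>
      rw [funext (herec i b hb)]
      exact (ih.add (hzm i b hb)).sub (hmv i b)
  have hgm : ∀ b, 1 ≤ b → Measurable (g b) := fun b hb =>
    (Finset.measurable_fun_sum _ fun i _ => hzm i b hb).const_smul (n : ℝ)⁻¹
  have hebarm : ∀ b, 1 ≤ b → Measurable (ebar b) := fun b hb =>
    (Finset.measurable_fun_sum _ fun i _ => hem i b hb).const_smul (n : ℝ)⁻¹
  have hvbarm : ∀ b, Measurable (vbar b) := by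
    intro b
    rw [funext (hvbar b)]
    exact (Finset.measurable_fun_sum _ fun i _ => hmv i b).const_smul (n : ℝ)⁻¹
  have hehatm : ∀ b, 1 ≤ b → Measurable (ehat b) := by
    intro b hb
    induction b, hb using Nat.le_induction with
    | base => rw [hehat1]; exact measurable_const
    | succ b hb ih =>
      rw [funext (hehatrec b hb)]
      exact (ih.add (hvbarm b)).sub (hms b)
  set c : ℝ≥0∞ := ENNReal.ofReal (L * G)
  have hebarL2 : ∀ b ∈ Finset.Icc 1 (K + 1), eLpNorm (ebar b) 2 μpr ≤ 2 * c := by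
    intro b hb
    have hb1 := (Finset.mem_Icc.1 hb).1
    refine eLpNorm_average_le μpr hn _ (fun i => e i b)
      (fun i _ => (hem i b hb1).aestronglyMeasurable) fun i hi => ?_
    exact eLpNorm_errorFeedback_le μpr K c (e i) (z i) (v i)
      (fun b hb => (hem i b hb).aestronglyMeasurable)
      (fun b hb => (hzm i b hb).aestronglyMeasurable)
      (fun b hb => eLpNorm_two_le_of_norm_le μpr (hznorm i hi b hb)) (he1 i) (herec i)
      (fun b hb => (hFCClearner i hi b hb).trans (by gcongr)) b hb
  have hebarrec : ∀ b, 1 ≤ b → ∀ ω, vbar b ω = g b ω + ebar b ω - ebar (b + 1) ω := by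
    intro b hb ω
    simp only [hvbar, hg, hebar, herec _ b hb ω, Finset.sum_add_distrib,
      Finset.sum_sub_distrib]
    module
  have hvbarL2 : ∀ b ∈ Finset.Icc 1 K, eLpNorm (vbar b) 2 μpr ≤ 5 * c := by
    intro b hb
    obtain ⟨hb1, hbK⟩ := Finset.mem_Icc.1 hb
    have h1 : vbar b = g b + ebar b - ebar (b + 1) := funext (hebarrec b hb1)
    have hgs := (hgm b hb1).aestronglyMeasurable (μ := μpr)
    have hes := (hebarm b hb1).aestronglyMeasurable (μ := μpr)
    have hes' := (hebarm (b + 1) (by omega)).aestronglyMeasurable (μ := μpr)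
    rw [h1]
    calc _ ≤ eLpNorm (g b) 2 μpr + eLpNorm (ebar b) 2 μpr + eLpNorm (ebar (b + 1)) 2 μpr :=
          (eLpNorm_sub_le (hgs.add hes) hes' (by norm_num)).trans
            (add_le_add_left (eLpNorm_add_le hgs hes (by norm_num)) _)
      _ ≤ c + 2 * c + 2 * c := by
        gcongr
        · exact eLpNorm_two_le_of_norm_le μpr (hgnorm b hb)
        · exact hebarL2 b (Finset.mem_Icc.2 ⟨hb1, by omega⟩)
        · exact hebarL2 (b + 1) (Finset.mem_Icc.2 ⟨by omega, by omega⟩)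
      _ = 5 * c := by ring
  have hehatL2 : ∀ b ∈ Finset.Icc 1 (K + 1), eLpNorm (ehat b) 2 μpr ≤ 2 * (5 * c) :=
    eLpNorm_errorFeedback_le μpr K (5 * c) ehat vbar s
      (fun b hb => (hehatm b hb).aestronglyMeasurable)
      (fun b _ => (hvbarm b).aestronglyMeasurable) hvbarL2 hehat1 hehatrec
      (fun b hb => (hFCCserver b hb).trans (by gcongr))
  have hsum : ∀ N ω, ∑ k ∈ Finset.Icc 1 N, s k ω
      = ∑ k ∈ Finset.Icc 1 N, g k ω - ebar (N + 1) ω - ehat (N + 1) ω := by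
    intro N ω
    induction N with
    | zero => simp [hebar, he1, hehat1]
    | succ N ih =>
      rw [Finset.sum_Icc_succ_top (by omega), Finset.sum_Icc_succ_top (by omega), ih,
        hehatrec (N + 1) (by omega), hebarrec (N + 1) (by omega)]
      abel
  have hmin : ∀ ω, ∀ b ∈ Finset.Icc 1 K, ∀ u ∈ W,
      ⟪∑ k ∈ Finset.Icc 1 (b - 3), s k ω, w b ω⟫
          + μ * L / 2 * ∑ k ∈ Finset.Icc 1 b, ‖w b ω - w k ω‖ ^ 2
        ≤ ⟪∑ k ∈ Finset.Icc 1 (b - 3), s k ω, u⟫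
          + μ * L / 2 * ∑ k ∈ Finset.Icc 1 b, ‖u - w k ω‖ ^ 2 := by
    intro ω b hb u hu
    obtain ⟨a, rfl⟩ : ∃ a, b = a + 1 := ⟨b - 1, by have := Finset.mem_Icc.1 hb; omega⟩
    have hnn : 0 ≤ μ * L / 2 * ‖u - w (a + 1) ω‖ ^ 2 := by positivity
    rw [Finset.sum_Icc_succ_top (by omega), Finset.sum_Icc_succ_top (by omega), sub_self,
      norm_zero, mul_add, mul_add]
    rcases Nat.eq_zero_or_pos a with rfl | ha
    · simpa using hnn
    · have h := hupdate a (Finset.mem_Icc.2 ⟨ha, by have := Finset.mem_Icc.1 hb; omega⟩) ω u hu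
      rw [show a + 1 - 3 = a - 2 by omega]
      linarith
  have hgap : ∀ ω, ∀ b ∈ Finset.Icc 1 K,
      ‖∑ k ∈ Finset.Icc 1 b, g k ω - ∑ k ∈ Finset.Icc 1 (b - 3), s k ω‖
        ≤ 3 * (L * G) + ‖ebar (b - 3 + 1) ω‖ + ‖ehat (b - 3 + 1) ω‖ := by
    intro ω b hb
    have hbK := (Finset.mem_Icc.1 hb).2
    have hsplit : ∑ k ∈ Finset.Icc 1 b, g k ω
        = ∑ k ∈ Finset.Icc 1 (b - 3), g k ω + ∑ k ∈ Finset.Ioc (b - 3) b, g k ω := by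
      have h : ∀ N, Finset.Icc 1 N = Finset.Ioc 0 N := fun N => by ext; simp; omega
      rw [h, h, Finset.sum_Ioc_consecutive _ (by omega) (by omega)]
    have htail : ‖∑ k ∈ Finset.Ioc (b - 3) b, g k ω‖ ≤ 3 * (L * G) := by
      refine (norm_sum_le_of_le _ fun k hk => hgnorm k ?_ ω).trans ?_
      · rw [Finset.mem_Ioc] at hk
        exact Finset.mem_Icc.2 ⟨by omega, by omega⟩
      · rw [Finset.sum_const, Nat.card_Ioc, nsmul_eq_mul]
        have : ((b - (b - 3) : ℕ) : ℝ) ≤ 3 := by exact_mod_cast (by omega : b - (b - 3) ≤ 3)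
        gcongr
    rw [hsplit, hsum]
    calc _ = ‖∑ k ∈ Finset.Ioc (b - 3) b, g k ω + ebar (b - 3 + 1) ω + ehat (b - 3 + 1) ω‖ := by
          congr 1; abel
      _ ≤ _ := norm_add₃_le.trans (by gcongr)
  have hpath : ∀ ω, (n : ℝ)⁻¹ * ∑ t ∈ Finset.Icc 1 (K * L), ∑ i ∈ Finset.Icc 1 n,
            f i t (w ((t + L - 1) / L) ω)
          - ⨅ u : W, (n : ℝ)⁻¹ * ∑ t ∈ Finset.Icc 1 (K * L), ∑ i ∈ Finset.Icc 1 n, f i t u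
      ≤ ∑ b ∈ Finset.Icc 1 K, 2 * G / μ * (b : ℝ)⁻¹ *
          (3 * (L * G) + ‖ebar (b - 3 + 1) ω‖ + ‖ehat (b - 3 + 1) ω‖) := by
    intro ω
    have : Nonempty W := ⟨⟨0, hW0⟩⟩
    rw [sub_le_comm]
    refine le_ciInf fun u => ?_
    rw [sub_le_comm]
    have hwω : ∀ b ∈ Finset.Icc 1 K, w b ω ∈ W := fun b hb => hwW b hb ω
    have h1 := blockRegret_le hn hL1 μ f hsc (fun b => w b ω) hwω u u.2
    have h2 := ftl_regret_le hWcpt hWconv (m := μ * L) (by positivity) K (fun b => g b ω)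
      (fun b => ∑ k ∈ Finset.Icc 1 (b - 3), s k ω) (fun b => w b ω) hwω (hmin ω) u u.2
    refine (h1.trans (le_of_eq ?_)).trans (h2.trans (Finset.sum_le_sum fun b hb => ?_))
    · refine Finset.sum_congr rfl fun b hb => ?_
      simp only [hg, hzdef _ b (Finset.mem_Icc.1 hb).1 ω]
    · have hb0 : (0 : ℝ) < b := by exact_mod_cast (Finset.mem_Icc.1 hb).1
      calc _ ≤ L * G * (2 * (3 * (L * G) + ‖ebar (b - 3 + 1) ω‖ + ‖ehat (b - 3 + 1) ω‖)
              / (μ * L * b)) := by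
            gcongr
            · exact hgnorm b hb ω
            · exact hgap ω b hb
        _ = _ := by field_simp
  have hblock : ∀ b ∈ Finset.Icc 1 K,
      ∫⁻ ω, ENNReal.ofReal (3 * (L * G) + ‖ebar (b - 3 + 1) ω‖ + ‖ehat (b - 3 + 1) ω‖) ∂μpr
        ≤ ENNReal.ofReal (15 * (L * G)) := by
    intro b hb
    have hbm : b - 3 + 1 ∈ Finset.Icc 1 (K + 1) := by
      rw [Finset.mem_Icc] at hb ⊢; omega
    have h1 := hebarm (b - 3 + 1) (by omega)
    have h2 := hehatm (b - 3 + 1) (by omega)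
    have h3 : ∀ ω, ENNReal.ofReal
        (3 * (L * G) + ‖ebar (b - 3 + 1) ω‖ + ‖ehat (b - 3 + 1) ω‖)
          = 3 * c + ‖ebar (b - 3 + 1) ω‖ₑ + ‖ehat (b - 3 + 1) ω‖ₑ := by
      intro ω
      rw [ENNReal.ofReal_add (by positivity) (by positivity),
        ENNReal.ofReal_add (by positivity) (by positivity), ENNReal.ofReal_mul (by norm_num),
        ofReal_norm, ofReal_norm, ENNReal.ofReal_ofNat]
    simp_rw [h3]
    rw [lintegral_add_right _ h2.enorm, lintegral_add_right _ h1.enorm, lintegral_const,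
      measure_univ, mul_one]
    calc _ ≤ 3 * c + 2 * c + 2 * (5 * c) := by
          gcongr
          · exact (lintegral_enorm_le_eLpNorm_two μpr h1.aestronglyMeasurable).trans
              (hebarL2 _ hbm)
          · exact (lintegral_enorm_le_eLpNorm_two μpr h2.aestronglyMeasurable).trans
              (hehatL2 _ hbm)
      _ = 15 * c := by ring
      _ = _ := by rw [ENNReal.ofReal_mul (by norm_num), ENNReal.ofReal_ofNat]
  have hmeas : ∀ b, Measurable fun ω =>
      ENNReal.ofReal (3 * (L * G) + ‖ebar (b - 3 + 1) ω‖ + ‖ehat (b - 3 + 1) ω‖) := fun b =>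
    ((measurable_const.add (hebarm (b - 3 + 1) (by omega)).norm).add
      (hehatm (b - 3 + 1) (by omega)).norm).ennreal_ofReal
  calc _ ≤ ∫⁻ ω, ∑ b ∈ Finset.Icc 1 K, ENNReal.ofReal (2 * G / μ * (b : ℝ)⁻¹) *
          ENNReal.ofReal (3 * (L * G) + ‖ebar (b - 3 + 1) ω‖ + ‖ehat (b - 3 + 1) ω‖) ∂μpr := by
        refine lintegral_mono fun ω => (ENNReal.ofReal_le_ofReal (hpath ω)).trans (le_of_eq ?_)
        rw [ENNReal.ofReal_sum_of_nonneg fun b _ => by positivity]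
        exact Finset.sum_congr rfl fun b _ => ENNReal.ofReal_mul (by positivity)
    _ = ∑ b ∈ Finset.Icc 1 K, ENNReal.ofReal (2 * G / μ * (b : ℝ)⁻¹) * ∫⁻ ω,
          ENNReal.ofReal (3 * (L * G) + ‖ebar (b - 3 + 1) ω‖ + ‖ehat (b - 3 + 1) ω‖) ∂μpr := by
        rw [lintegral_finsetSum _ fun b _ => (hmeas b).const_mul _]
        exact Finset.sum_congr rfl fun b _ => lintegral_const_mul _ (hmeas b)
    _ ≤ ∑ b ∈ Finset.Icc 1 K, ENNReal.ofReal (2 * G / μ * (b : ℝ)⁻¹) *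
          ENNReal.ofReal (15 * (L * G)) :=
        Finset.sum_le_sum fun b hb => by gcongr; exact hblock b hb
    _ = ENNReal.ofReal (30 * L * G ^ 2 / μ * ∑ b ∈ Finset.Icc 1 K, (b : ℝ)⁻¹) := by
        rw [Finset.mul_sum, ENNReal.ofReal_sum_of_nonneg fun b _ => by positivity]
        refine Finset.sum_congr rfl fun b _ => ?_
        rw [← ENNReal.ofReal_mul (by positivity)]
        congr 1; ring
    _ ≤ _ := by
        refine ENNReal.ofReal_le_ofReal ?_
        have hK : (1 : ℝ) ≤ K := by
          exact_mod_cast Nat.pos_of_ne_zero fun h => by simp [h] at hT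
        have hKL : (K : ℝ) ≤ (K * L : ℕ) := by exact_mod_cast Nat.le_mul_of_pos_right K hL1
        have hlog : Real.log K ≤ Real.log (K * L : ℕ) := Real.log_le_log (by linarith) hKL
        have hlog0 : 0 ≤ Real.log K := Real.log_nonneg hK
        calc _ ≤ 30 * L * G ^ 2 / μ * (1 + Real.log (K * L : ℕ)) := by
              gcongr
              exact (sum_Icc_inv_le_one_add_log K).trans (by linarith)
          _ ≤ 42 * L * (G + μ * D) ^ 2 / μ * (1 + Real.log (K * L : ℕ)) := by
              have : 0 ≤ μ * D := by positivity
              gcongr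
              · linarith
              · exact le_add_of_nonneg_right this
          _ = _ := by ring
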